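/- For every rational ℓ > 1 there exists N(ℓ) ∈ ℕ such that for all integers m > N(ℓ) with ℓ·m ∈ ℤ, the polynomial (1+x)^{ℓm} + (1+x)^m - 1 has a complex root x with Re(x) > 0; hence the complete bipartite graph K_{m, ℓm} is not stable. -/

import Mathlib

open Polynomial Filter Topology

theorem Multiset.norm_prod_le_one_of_forall_norm_le_one (s : Multiset ℂ)
    (h : ∀ z ∈ s, ‖z‖ ≤ 1) : ‖s.prod‖ ≤ 1 := by
  induction s using Multiset.induction_on with
  | empty => simp
  | cons a s ih =>
    rw [Multiset.prod_cons, norm_mul]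
    exact mul_le_one₀ (h a (Multiset.mem_cons_self a s)) (norm_nonneg _)
      (ih fun z hz => h z (Multiset.mem_cons_of_mem hz))

/-- A monic complex polynomial whose constant coefficient has norm greater than one has a root
outside the closed unit disc. -/
theorem Polynomial.Monic.exists_isRoot_one_lt_norm {Q : ℂ[X]} (hQ : Q.Monic)
    (h0 : 1 < ‖Q.coeff 0‖) : ∃ w, Q.IsRoot w ∧ 1 < ‖w‖ := by
  by_contra! h
  have hprod := (IsAlgClosed.splits Q).coeff_zero_eq_prod_roots_of_monic hQ
  have hle := Multiset.norm_prod_le_one_of_forall_norm_le_one Q.roots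
    fun z hz => h z (Polynomial.isRoot_of_mem_roots hz)
  rw [hprod] at h0
  simp at h0
  linarith

theorem exists_one_lt_norm_pow_add_pow_eq_one {a b : ℕ} (hb : 0 < b) (hab : b < a) :
    ∃ w : ℂ, w ^ a + w ^ b = 1 ∧ 1 < ‖w‖ := by
  have ha : 0 < a := hb.trans hab
  obtain ⟨r, ⟨hr0, hr1⟩, hr⟩ : ∃ r ∈ Set.Ioo (0 : ℝ) 1, r ^ a + r ^ b = 1 := by
    have := intermediate_value_Ioo (zero_le_one' ℝ)
      (f := fun r : ℝ => r ^ a + r ^ b) (by fun_prop)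
    exact this ⟨by simp [ha.ne', hb.ne'], by norm_num⟩
  set P : ℂ[X] := X ^ a + (X ^ b - 1) with hP
  have hPm : P.Monic := by
    refine monic_X_pow_add ?_
    refine (degree_sub_le _ _).trans_lt (max_lt ?_ ?_)
    · rw [degree_X_pow]
      exact_mod_cast hab
    · rw [degree_one]
      exact_mod_cast ha
  have hroot : P.IsRoot (r : ℂ) := by
    have : ((r : ℂ)) ^ a + (r : ℂ) ^ b = 1 := by exact_mod_cast hr
    simp only [hP, IsRoot.def, eval_add, eval_sub, eval_pow, eval_X, eval_one]
    linear_combination this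
  obtain ⟨Q, hQ⟩ := dvd_iff_isRoot.mpr hroot
  have hQm : Q.Monic := (monic_X_sub_C (r : ℂ)).of_mul_monic_left (hQ ▸ hPm)
  have hc : r * ‖Q.coeff 0‖ = 1 := by
    have h1 := congrArg (fun p => ‖p.coeff 0‖) hQ
    simpa [hP, mul_coeff_zero, coeff_X_pow, ha.ne, hb.ne, ha.ne', hb.ne', abs_of_pos hr0]
      using h1.symm
  obtain ⟨w, hw, hw1⟩ := hQm.exists_isRoot_one_lt_norm (by nlinarith [norm_nonneg (Q.coeff 0)])
  refine ⟨w, ?_, hw1⟩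
  have hPw : P.eval w = 0 := by rw [hQ, eval_mul, hw.eq_zero, mul_zero]
  simp only [hP, eval_add, eval_sub, eval_pow, eval_X, eval_one] at hPw
  linear_combination hPw

theorem Complex.eventually_one_lt_re_exp_div {c : ℂ} (hc : 0 < c.re) :
    ∀ᶠ k : ℕ in atTop, 1 < (Complex.exp (c / k)).re := by
  have hd : HasDerivAt (fun t : ℂ => Complex.exp (c * t)) c 0 := by
    simpa using ((hasDerivAt_id (0 : ℂ)).const_mul c).cexp
  have hr : HasDerivAt (fun t : ℝ => (Complex.exp (c * t)).re) c.re 0 :=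
    HasDerivAt.real_of_complex (z := 0) (by simpa using hd)
  have hslope := (hasDerivAt_iff_tendsto_slope.mp hr).eventually (lt_mem_nhds hc)
  have hlim : Tendsto (fun k : ℕ => ((k : ℝ))⁻¹) atTop (𝓝[≠] 0) := by
    refine tendsto_nhdsWithin_iff.mpr ⟨tendsto_inv_atTop_nhds_zero_nat, ?_⟩
    filter_upwards [eventually_gt_atTop 0] with k hk
    simpa using hk.ne'
  filter_upwards [hlim.eventually hslope, eventually_gt_atTop 0] with k hk hk0
  have hkpos : (0 : ℝ) < (k : ℝ)⁻¹ := by positivity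
  rw [slope_def_field, sub_zero, div_pos_iff_of_pos_right hkpos, sub_pos] at hk
  simpa [div_eq_mul_inv] using hk

theorem Kmlm_not_stable (ℓ : ℚ) (hℓ : 1 < ℓ) :
    ∃ N : ℕ, ∀ m : ℕ, N < m → (ℓ * m).den = 1 →
      ∃ x : ℂ, (1 + x) ^ (ℓ * m).num.toNat + (1 + x) ^ m - 1 = 0 ∧ 0 < x.re := by
  have hb : 0 < ℓ.den := ℓ.den_pos
  obtain ⟨a, ha⟩ : ∃ a : ℕ, ℓ.num = a :=
    Int.eq_ofNat_of_zero_le (Rat.num_nonneg.mpr (by linarith))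
  have hdiv : ℓ * ℓ.den = a := by
    rw [Rat.mul_den_eq_num, ha]
    simp
  have hab : ℓ.den < a := by
    have hbq : (0 : ℚ) < ℓ.den := by exact_mod_cast hb
    have : (ℓ.den : ℚ) < a := by nlinarith
    exact_mod_cast this
  obtain ⟨w, hw, hw1⟩ := exists_one_lt_norm_pow_add_pow_eq_one hb hab
  have hw0 : w ≠ 0 := norm_pos_iff.mp (by linarith)
  obtain ⟨K, hK⟩ := eventually_atTop.mp (Complex.eventually_one_lt_re_exp_div (c := Complex.log w)
    (by rw [Complex.log_re]; exact Real.log_pos hw1))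
  refine ⟨ℓ.den * K, fun m hm hden => ?_⟩
  obtain ⟨k, rfl⟩ : ℓ.den ∣ m := by
    have hn : ℓ * m = (ℓ * m).num := ((Rat.den_eq_one_iff _).mp hden).symm
    have hmul : (a * m : ℤ) = ℓ.den * (ℓ * m).num := by
      have : (a * m : ℚ) = ℓ.den * (ℓ * m).num := by
        rw [← hn, ← hdiv]
        ring
      exact_mod_cast this
    have hcop : Nat.Coprime ℓ.den a := by
      have := ℓ.reduced
      rw [ha] at this
      exact this.symm
    exact hcop.dvd_of_dvd_mul_left (by exact_mod_cast Dvd.intro _ hmul.symm)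
  have hkK : K < k := lt_of_mul_lt_mul_left hm (Nat.zero_le _)
  have hk0 : (k : ℂ) ≠ 0 := by exact_mod_cast (Nat.zero_le K |>.trans_lt hkK).ne'
  have hexp : (ℓ * (ℓ.den * k : ℕ)).num.toNat = k * a := by
    have : ℓ * (ℓ.den * k : ℕ) = (k * a : ℕ) := by
      push_cast
      rw [← hdiv]
      ring
    rw [this, Rat.num_natCast, Int.toNat_natCast]
  have hpow : Complex.exp (Complex.log w / k) ^ k = w := by
    rw [← Complex.exp_nat_mul, mul_div_cancel₀ _ hk0, Complex.exp_log hw0]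
  refine ⟨Complex.exp (Complex.log w / k) - 1, ?_, ?_⟩
  · rw [hexp, add_sub_cancel, mul_comm ℓ.den k, pow_mul, pow_mul, hpow, hw, sub_self]
  · simpa using hK k hkK.le
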